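/- The series ∑_{n=0}^∞ C(2n,n)² · P_n(101/91) · (91/3600)^n · (5537 + 11304n − 173328n² + 53824n³) converges to 87750/π. -/

import Mathlib

open Real Filter

/-- The Legendre polynomial of degree `n`, given by the explicit formula
`P_n(x) = 2^{-n} ∑_{j=0}^{n} C(n,j)^2 (x-1)^{n-j} (x+1)^j`. -/
noncomputable def legendreP (n : ℕ) (x : ℝ) : ℝ :=
  (2 : ℝ)⁻¹ ^ n *
    ∑ j ∈ Finset.range (n + 1), (n.choose j : ℝ) ^ 2 * (x - 1) ^ (n - j) * (x + 1) ^ j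

/-- `HasRadius a R`: the power series with coefficients `a` converges absolutely on the open disc
of radius `R`. -/
def HasRadius {𝕜 : Type*} [RCLike 𝕜] (a : ℕ → 𝕜) (R : ℝ) : Prop :=
  ∀ r : ℝ, 0 ≤ r → r < R → Summable fun n => ‖a n‖ * r ^ n

namespace HasRadius

variable {𝕜 : Type*} [RCLike 𝕜] {a : ℕ → 𝕜} {R : ℝ}

theorem summable (h : HasRadius a R) {x : 𝕜} (hx : ‖x‖ < R) : Summable fun n => a n * x ^ n :=
  Summable.of_norm (by simpa [norm_mul, norm_pow] using h ‖x‖ (norm_nonneg x) hx)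

theorem nat_mul (h : HasRadius a R) : HasRadius (fun n => (n : 𝕜) * a n) R := by
  intro r hr hrR
  obtain ⟨s, hrs, hsR⟩ := exists_between hrR
  have hs : 0 < s := hr.trans_lt hrs
  have hq : ‖r / s‖ < 1 := by
    rw [Real.norm_of_nonneg (by positivity), div_lt_one hs]
    exact hrs
  have hb := (summable_norm_pow_mul_geometric_of_norm_lt_one 1 hq).tendsto_atTop_zero.bddAbove_range
  obtain ⟨B, hB⟩ := hb
  refine Summable.of_nonneg_of_le (fun n => by positivity) (fun n => ?_)
    ((h s hs.le hsR).mul_left B)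
  have h1 : (n : ℝ) * (r / s) ^ n ≤ B := by
    have := hB ⟨n, rfl⟩
    simp only [pow_one, norm_mul, norm_pow] at this
    rwa [Real.norm_of_nonneg (by positivity), Real.norm_of_nonneg (by positivity)] at this
  have h2 : r ^ n = (r / s) ^ n * s ^ n := by
    rw [← mul_pow, div_mul_cancel₀ _ hs.ne']
  calc ‖(n : 𝕜) * a n‖ * r ^ n = ((n : ℝ) * (r / s) ^ n) * (‖a n‖ * s ^ n) := by
        rw [norm_mul, RCLike.norm_natCast, h2]; ring
    _ ≤ B * (‖a n‖ * s ^ n) := by gcongr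

theorem shift (h : HasRadius a R) : HasRadius (fun n => a (n + 1)) R := by
  intro r hr hrR
  rcases hr.eq_or_lt with rfl | hr'
  · refine summable_of_ne_finset_zero (s := {0}) (fun n hn => ?_)
    simp at hn
    simp [hn]
  · have := ((summable_nat_add_iff 1).2 (h r hr hrR)).mul_right r⁻¹
    refine this.congr (fun n => ?_)
    rw [pow_succ]
    field_simp

theorem derivCoeff (h : HasRadius a R) :
    HasRadius (fun n => ((n + 1 : ℕ) : 𝕜) * a (n + 1)) R :=
  h.nat_mul.shift

theorem hasDerivAt (h : HasRadius a R) {x : 𝕜} (hx : ‖x‖ < R) :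
    HasDerivAt (fun y => ∑' n, a n * y ^ n)
      (∑' n, ((n + 1 : ℕ) : 𝕜) * a (n + 1) * x ^ n) x := by
  obtain ⟨s, hxs, hsR⟩ := exists_between hx
  have hs : 0 < s := (norm_nonneg x).trans_lt hxs
  have hsum : Summable fun n => ‖a n‖ * ((n : ℝ) * s ^ (n - 1)) := by
    rw [← summable_nat_add_iff 1]
    refine (h.derivCoeff s hs.le hsR).congr (fun n => ?_)
    rw [norm_mul, RCLike.norm_natCast]
    simp only [Nat.add_sub_cancel]
    ring
  have key := hasDerivAt_tsum_of_isPreconnected (g := fun n y => a n * y ^ n)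
    (g' := fun n y => a n * ((n : 𝕜) * y ^ (n - 1))) (y₀ := 0) (y := x)
    (t := Metric.ball (0 : 𝕜) s) hsum Metric.isOpen_ball
    (convex_ball (0 : 𝕜) s).isPreconnected
    (fun n y _ => (hasDerivAt_pow n y).const_mul (a n))
    (fun n y hy => by
      rw [norm_mul, norm_mul, norm_pow, RCLike.norm_natCast]
      have : ‖y‖ ≤ s := by simpa using (mem_ball_zero_iff.1 hy).le
      gcongr)
    (Metric.mem_ball_self hs) (h.summable (by simpa using hs.trans hsR))
    (mem_ball_zero_iff.2 hxs)
  have hs2 : Summable fun n => a n * ((n : 𝕜) * x ^ (n - 1)) := by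
    refine Summable.of_norm_bounded hsum (fun n => ?_)
    rw [norm_mul, norm_mul, norm_pow, RCLike.norm_natCast]
    gcongr
  rw [hs2.tsum_eq_zero_add] at key
  simp only [Nat.add_sub_cancel, Nat.cast_zero, zero_mul, mul_zero, zero_add] at key
  rwa [tsum_congr fun n => (by ring :
    ((n + 1 : ℕ) : 𝕜) * a (n + 1) * x ^ n = a (n + 1) * (((n + 1 : ℕ) : 𝕜) * x ^ n))]

theorem tsum_mul_self (h : HasRadius a R) {x : 𝕜} (hx : ‖x‖ < R) :
    x * ∑' n, a (n + 1) * x ^ n = (∑' n, a n * x ^ n) - a 0 := by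
  rw [(h.summable hx).tsum_eq_zero_add, ← tsum_mul_left]
  simp only [pow_zero, mul_one, add_sub_cancel_left]
  exact tsum_congr fun n => by ring

end HasRadius

/-- The Taylor coefficients `C(2n,n)² / 16^n` of the normalised complete elliptic integral of the
first kind. -/
noncomputable def ellCoeff (𝕜 : Type*) [Field 𝕜] (n : ℕ) : 𝕜 := (n.centralBinom : 𝕜) ^ 2 / 16 ^ n

/-- The normalised complete elliptic integral of the first kind `₂F₁(1/2, 1/2; 1; x)`. -/
noncomputable def ellF {𝕜 : Type*} [RCLike 𝕜] (x : 𝕜) : 𝕜 := ∑' n, ellCoeff 𝕜 n * x ^ n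

/-- The derivative of `ellF`. -/
noncomputable def ellF' {𝕜 : Type*} [RCLike 𝕜] (x : 𝕜) : 𝕜 :=
  ∑' n, ((n + 1 : ℕ) : 𝕜) * ellCoeff 𝕜 (n + 1) * x ^ n

section Elliptic

variable {𝕜 : Type*} [RCLike 𝕜]

@[simp] theorem ellCoeff_zero : ellCoeff 𝕜 0 = 1 := by simp [ellCoeff]

theorem ellCoeff_succ (n : ℕ) :
    ((n : 𝕜) + 1) ^ 2 * ellCoeff 𝕜 (n + 1) = ((n : 𝕜) + 1 / 2) ^ 2 * ellCoeff 𝕜 n := by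
  have h : ((n : 𝕜) + 1) * ((n + 1).centralBinom : 𝕜) = 2 * (2 * n + 1) * (n.centralBinom : 𝕜) := by
    exact_mod_cast Nat.succ_mul_centralBinom_succ n
  unfold ellCoeff
  rw [← mul_div_assoc, ← mul_pow, h, pow_succ (16 : 𝕜)]
  field_simp
  ring

theorem norm_ellCoeff (n : ℕ) : ‖ellCoeff 𝕜 n‖ = ellCoeff ℝ n := by
  simp [ellCoeff]

theorem ellCoeff_le_one (n : ℕ) : ellCoeff ℝ n ≤ 1 := by
  unfold ellCoeff
  rw [div_le_one (by positivity)]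
  have : (n.centralBinom : ℝ) ≤ 4 ^ n := by exact_mod_cast Nat.centralBinom_le_four_pow n
  calc (n.centralBinom : ℝ) ^ 2 ≤ (4 ^ n) ^ 2 := by gcongr
    _ = 16 ^ n := by rw [← pow_mul, mul_comm, pow_mul]; norm_num

theorem hasRadius_ellCoeff : HasRadius (ellCoeff 𝕜) 1 := by
  intro r hr hr1
  refine Summable.of_nonneg_of_le (fun n => by positivity) (fun n => ?_)
    (summable_geometric_of_lt_one hr hr1)
  rw [norm_ellCoeff]
  exact mul_le_of_le_one_left (by positivity) (ellCoeff_le_one n)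

theorem ellF_zero : ellF (0 : 𝕜) = 1 := by
  unfold ellF
  rw [tsum_eq_single 0 (fun n hn => by simp [hn])]
  simp

theorem hasDerivAt_ellF {x : 𝕜} (hx : ‖x‖ < 1) : HasDerivAt ellF (ellF' x) x :=
  hasRadius_ellCoeff.hasDerivAt hx

/-- The coefficients of `x (1 - x) dF/dx`, where `F = ellF`. -/
noncomputable def ellThetaCoeff (𝕜 : Type*) [Field 𝕜] (n : ℕ) : 𝕜 :=
  n * ellCoeff 𝕜 n - ((n - 1 : ℕ) : 𝕜) * ellCoeff 𝕜 (n - 1)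

theorem hasRadius_ellThetaCoeff : HasRadius (ellThetaCoeff 𝕜) 1 := by
  intro r hr hr1
  have h1 := (hasRadius_ellCoeff (𝕜 := 𝕜)).nat_mul r hr hr1
  have h2 : Summable fun n : ℕ => ‖((n - 1 : ℕ) : 𝕜) * ellCoeff 𝕜 (n - 1)‖ * r ^ n := by
    rw [← summable_nat_add_iff 1]
    refine (h1.mul_right r).congr fun n => ?_
    simp only [Nat.add_sub_cancel]
    ring
  refine Summable.of_nonneg_of_le (fun n => by positivity) (fun n => ?_) (h1.add h2)
  rw [← add_mul]
  gcongr
  exact norm_sub_le _ _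

theorem tsum_ellThetaCoeff {x : 𝕜} (hx : ‖x‖ < 1) :
    ∑' n, ellThetaCoeff 𝕜 n * x ^ n = x * (1 - x) * ellF' x := by
  have h1 := (hasRadius_ellCoeff (𝕜 := 𝕜)).nat_mul
  have h3 := h1.tsum_mul_self hx
  have h4 := (hasRadius_ellThetaCoeff (𝕜 := 𝕜)).tsum_mul_self hx
  have e0 : ellThetaCoeff 𝕜 0 = 0 := by simp [ellThetaCoeff]
  rw [e0, sub_zero] at h4
  rw [← h4, mul_assoc]
  congr 1
  simp only [Nat.cast_zero, zero_mul, sub_zero] at h3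
  have h5 : ellF' x = ∑' n, ((n + 1 : ℕ) : 𝕜) * ellCoeff 𝕜 (n + 1) * x ^ n := rfl
  rw [sub_mul, one_mul, h5, h3, ← Summable.tsum_sub (h1.shift.summable hx) (h1.summable hx)]
  refine tsum_congr fun n => ?_
  simp only [ellThetaCoeff, Nat.add_sub_cancel]
  ring

/-- The hypergeometric differential equation of `ellF` in self-adjoint form. -/
theorem hasDerivAt_ellTheta {x : 𝕜} (hx : ‖x‖ < 1) :
    HasDerivAt (fun y : 𝕜 => y * (1 - y) * ellF' y) (ellF x / 4) x := by
  have h := (hasRadius_ellThetaCoeff (𝕜 := 𝕜)).hasDerivAt hx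
  have e : ∑' n, ((n + 1 : ℕ) : 𝕜) * ellThetaCoeff 𝕜 (n + 1) * x ^ n = ellF x / 4 := by
    unfold ellF
    rw [← tsum_div_const]
    refine tsum_congr fun n => ?_
    have := ellCoeff_succ (𝕜 := 𝕜) n
    simp only [ellThetaCoeff, Nat.add_sub_cancel]
    push_cast
    linear_combination x ^ n * this
  rw [e] at h
  refine h.congr_of_eventuallyEq ?_
  have : Metric.ball (0 : 𝕜) 1 ∈ nhds x := Metric.isOpen_ball.mem_nhds (by simpa using hx)
  filter_upwards [this] with y hy
  exact (tsum_ellThetaCoeff (by simpa using hy)).symm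

end Elliptic

theorem tendsto_nat_mul_ellCoeff :
    Tendsto (fun n : ℕ => (n : ℝ) * ellCoeff ℝ n) atTop (nhds (1 / π)) := by
  have hW : ∀ n : ℕ, (n : ℝ) * ellCoeff ℝ n = (n : ℝ) / (2 * n + 1) * (Wallis.W n)⁻¹ := by
    intro n
    have hc : (n.centralBinom : ℝ) = (2 * n).factorial / (n.factorial : ℝ) ^ 2 := by
      rw [eq_div_iff (by positivity)]
      have := Nat.choose_mul_factorial_mul_factorial (n := 2 * n) (k := n) (by omega)
      rw [show 2 * n - n = n by omega] at this
      rw [Nat.centralBinom_eq_two_mul_choose]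
      calc _ = (((2 * n).choose n * n.factorial * n.factorial : ℕ) : ℝ) := by push_cast; ring
        _ = _ := by rw [this]
    rw [Wallis.W_eq_factorial_ratio, ellCoeff, hc, pow_mul]
    field_simp
    norm_num
  simp_rw [hW]
  have h1 : Tendsto (fun n : ℕ => (n : ℝ) / (2 * n + 1)) atTop (nhds (1 / 2)) := by
    have h := (tendsto_const_nhds (x := (2 : ℝ))).add tendsto_one_div_atTop_nhds_zero_nat
    have h' := h.inv₀ (by norm_num)
    refine (h'.congr' ?_).trans (by norm_num)
    filter_upwards [eventually_gt_atTop 0] with n hn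
    have : (0 : ℝ) < n := by exact_mod_cast hn
    field_simp
  have h2 := h1.mul (Wallis.tendsto_W_nhds_pi_div_two.inv₀ (by positivity))
  refine h2.trans (by rw [show 1 / 2 * (π / 2)⁻¹ = 1 / π by field_simp])

theorem tendsto_ellCoeff : Tendsto (ellCoeff ℝ) atTop (nhds 0) := by
  have h := tendsto_nat_mul_ellCoeff.mul tendsto_one_div_atTop_nhds_zero_nat
  rw [mul_zero] at h
  refine h.congr' ?_
  filter_upwards [eventually_gt_atTop 0] with n hn
  have : (0 : ℝ) < n := by exact_mod_cast hn
  field_simp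

theorem tendsto_ellTheta_one :
    Tendsto (fun x : ℝ => x * (1 - x) * ellF' x) (nhdsWithin 1 (Set.Iio 1)) (nhds (1 / π)) := by
  have hs : Tendsto (fun n => ∑ i ∈ Finset.range n, ellThetaCoeff ℝ i) atTop (nhds (1 / π)) := by
    rw [← tendsto_add_atTop_iff_nat 1]
    refine tendsto_nat_mul_ellCoeff.congr fun n => ?_
    induction n with
    | zero => simp [ellThetaCoeff]
    | succ n ih => rw [Finset.sum_range_succ, ← ih]; simp [ellThetaCoeff]
  refine (Real.tendsto_tsum_powerSeries_nhdsWithin_lt hs).congr' ?_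
  filter_upwards [Ioo_mem_nhdsLT (show (0 : ℝ) < 1 by norm_num)] with x hx
  exact tsum_ellThetaCoeff (by rw [Real.norm_of_nonneg hx.1.le]; exact hx.2)

theorem tendsto_one_sub_mul_ellF :
    Tendsto (fun x : ℝ => (1 - x) * ellF x) (nhdsWithin 1 (Set.Iio 1)) (nhds 0) := by
  have hs : Tendsto (fun n => ∑ i ∈ Finset.range n,
      (ellCoeff ℝ (i + 1) - ellCoeff ℝ i)) atTop (nhds (0 - 1)) := by
    simp_rw [Finset.sum_range_sub, ellCoeff_zero]
    exact tendsto_ellCoeff.sub_const 1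
  have h1 := Real.tendsto_tsum_powerSeries_nhdsWithin_lt hs
  have h2 : Tendsto (fun x : ℝ => x) (nhdsWithin 1 (Set.Iio 1)) (nhds 1) :=
    tendsto_id.mono_left nhdsWithin_le_nhds
  have h3 := (h2.mul h1).add_const 1
  refine (h3.congr' ?_).trans (by norm_num)
  filter_upwards [Ioo_mem_nhdsLT (show (0 : ℝ) < 1 by norm_num)] with x hx
  have hx' : ‖x‖ < 1 := by rw [Real.norm_of_nonneg hx.1.le]; exact hx.2
  have hr := hasRadius_ellCoeff (𝕜 := ℝ)
  have h := hr.tsum_mul_self hx'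
  simp_rw [sub_mul (ellCoeff ℝ _)]
  rw [Summable.tsum_sub (hr.shift.summable hx') (hr.summable hx'), mul_sub, h, ellCoeff_zero]
  unfold ellF
  ring

theorem continuousAt_ellF' {𝕜 : Type*} [RCLike 𝕜] {x : 𝕜} (hx : ‖x‖ < 1) :
    ContinuousAt ellF' x :=
  (hasRadius_ellCoeff.derivCoeff.hasDerivAt hx).continuousAt

/-- Legendre's relation, combined with the Landen transformation. -/
theorem legendre_relation_landen {k : ℝ} (hk0 : 0 < k) (hk1 : k < 1) :
    (1 + k) * ellF (k ^ 2) * (((1 - k) / (1 + k)) ^ 2 * (1 - ((1 - k) / (1 + k)) ^ 2) *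
        ellF' (((1 - k) / (1 + k)) ^ 2)) +
      (k * (1 - k) * ellF (k ^ 2) + 2 * (k ^ 2 * (1 - k ^ 2) * ellF' (k ^ 2))) / (1 + k) *
        ellF (((1 - k) / (1 + k)) ^ 2) = 1 / π := by
  set W : ℝ → ℝ := fun k => (1 + k) * ellF (k ^ 2) * (((1 - k) / (1 + k)) ^ 2 *
        (1 - ((1 - k) / (1 + k)) ^ 2) * ellF' (((1 - k) / (1 + k)) ^ 2)) +
      (k * (1 - k) * ellF (k ^ 2) + 2 * (k ^ 2 * (1 - k ^ 2) * ellF' (k ^ 2))) / (1 + k) *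
        ellF (((1 - k) / (1 + k)) ^ 2) with hW
  have hm : ∀ x : ℝ, 0 < x → x < 1 → 0 < (1 - x) / (1 + x) ∧ (1 - x) / (1 + x) < 1 := by
    intro x h0 h1
    refine ⟨div_pos (by linarith) (by linarith), ?_⟩
    rw [div_lt_one (by linarith)]
    linarith
  have hd : ∀ x ∈ Set.Ioo (0 : ℝ) 1, HasDerivAt W 0 x := by
    rintro x ⟨h0, h1⟩
    have hx2 : ‖x ^ 2‖ < 1 := by
      rw [Real.norm_of_nonneg (by positivity)]
      nlinarith
    have hm2 : ‖((1 - x) / (1 + x)) ^ 2‖ < 1 := by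
      rw [Real.norm_of_nonneg (by positivity)]
      nlinarith [hm x h0 h1]
    have hp : 1 + x ≠ 0 := by linarith
    have hq : 1 - x ≠ 0 := by linarith
    have ds : HasDerivAt (fun y : ℝ => y ^ 2) (2 * x) x := by simpa using hasDerivAt_pow 2 x
    have d1 : HasDerivAt (fun y : ℝ => 1 + y) 1 x := (hasDerivAt_id x).const_add 1
    have d2 : HasDerivAt (fun y : ℝ => 1 - y) (-1) x := (hasDerivAt_id x).const_sub 1
    have dm : HasDerivAt (fun y : ℝ => ((1 - y) / (1 + y)) ^ 2)
        (-4 * (1 - x) / (1 + x) ^ 3) x := by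
      have d3 : HasDerivAt (fun y : ℝ => (1 - y) / (1 + y)) (-2 / (1 + x) ^ 2) x :=
        (d2.div d1 hp).congr_deriv (by field_simp; ring)
      refine (d3.pow 2).congr_deriv ?_
      norm_num
      field_simp
      ring
    have df := HasDerivAt.comp (h := fun y : ℝ => y ^ 2) x (hasDerivAt_ellF hx2) ds
    have de := HasDerivAt.comp (h := fun y : ℝ => y ^ 2) x (hasDerivAt_ellTheta hx2) ds
    have dg := HasDerivAt.comp (h := fun y : ℝ => ((1 - y) / (1 + y)) ^ 2) x (hasDerivAt_ellF hm2) dm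
    have dp := HasDerivAt.comp (h := fun y : ℝ => ((1 - y) / (1 + y)) ^ 2) x (hasDerivAt_ellTheta hm2) dm
    have := ((d1.mul df).mul dp).add
      (((((hasDerivAt_id x).mul d2).mul df).add (de.const_mul 2)).div d1 hp |>.mul dg)
    refine this.congr_deriv ?_
    simp only [Function.comp_apply, Pi.mul_apply, Pi.add_apply, Pi.div_apply, id_eq]
    field_simp
    ring
  have hc : ∀ x ∈ Set.Ioo (0 : ℝ) 1, W x = W k := fun x hx =>
    isOpen_Ioo.is_const_of_deriv_eq_zero isPreconnected_Ioo
      (fun y hy => (hd y hy).differentiableAt.differentiableWithinAt)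
      (fun y hy => (hd y hy).deriv) hx ⟨hk0, hk1⟩
  have hlim : Tendsto W (nhdsWithin 0 (Set.Ioi 0)) (nhds (1 / π)) := by
    have hI : Set.Ioo (0 : ℝ) 1 ∈ nhdsWithin (0 : ℝ) (Set.Ioi 0) :=
      Ioo_mem_nhdsGT zero_lt_one
    have tx : Tendsto (fun x : ℝ => x) (nhdsWithin 0 (Set.Ioi 0)) (nhds 0) :=
      tendsto_id.mono_left nhdsWithin_le_nhds
    have tx2 : Tendsto (fun x : ℝ => x ^ 2) (nhdsWithin 0 (Set.Ioi 0)) (nhds 0) := by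
      simpa using tx.pow 2
    have tF : Tendsto (fun x : ℝ => ellF (x ^ 2)) (nhdsWithin 0 (Set.Ioi 0)) (nhds 1) := by
      have := (hasDerivAt_ellF (x := (0 : ℝ)) (by simp)).continuousAt.tendsto.comp tx2
      rwa [ellF_zero] at this
    have tF' : Tendsto (fun x : ℝ => ellF' (x ^ 2)) (nhdsWithin 0 (Set.Ioi 0))
        (nhds (ellF' 0)) :=
      (continuousAt_ellF' (x := (0 : ℝ)) (by simp)).tendsto.comp tx2
    have tm : Tendsto (fun x : ℝ => ((1 - x) / (1 + x)) ^ 2) (nhdsWithin 0 (Set.Ioi 0))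
        (nhdsWithin 1 (Set.Iio 1)) := by
      refine tendsto_nhdsWithin_iff.2 ⟨?_, ?_⟩
      · have := ((tx.const_sub 1).div (tx.const_add 1) (by norm_num)).pow 2
        simpa using this
      · filter_upwards [hI] with x hx
        have := hm x hx.1 hx.2
        rw [Set.mem_Iio]
        nlinarith
    have tp := tendsto_ellTheta_one.comp tm
    have tg := tendsto_one_sub_mul_ellF.comp tm
    have t1 := tx.const_add 1
    have t2 := tx.const_sub 1
    have := ((t1.mul tF).mul tp).add (((((t2.mul tF).add
      (((tx.mul (tx2.const_sub 1)).mul tF').const_mul 2)).div t1 (by norm_num)).mul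
      (((t1.pow 2).div_const 4).mul tg)))
    refine (this.congr' ?_).trans (by simp)
    filter_upwards [hI] with x hx
    have hp : 1 + x ≠ 0 := by linarith [hx.1]
    simp only [Function.comp_apply, hW, Pi.div_apply]
    congr 1
    generalize ellF (((1 - x) / (1 + x)) ^ 2) = g
    field_simp
    ring
  have hlim2 : Tendsto W (nhdsWithin 0 (Set.Ioi 0)) (nhds (W k)) := by
    refine tendsto_const_nhds.congr' ?_
    filter_upwards [Ioo_mem_nhdsGT (zero_lt_one (α := ℝ))] with x hx
    exact (hc x hx).symm
  exact tendsto_nhds_unique hlim2 hlim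

section Brafman

open Finset.HasAntidiagonal

/-- The homogeneous form `∑ C(n,i)² X^i Y^(n-i)` of the Legendre polynomial. -/
def legendreForm {R : Type*} [CommSemiring R] (n : ℕ) (X Y : R) : R :=
  ∑ ij ∈ antidiagonal n, (n.choose ij.1 : R) ^ 2 * (X ^ ij.1 * Y ^ ij.2)

theorem norm_legendreForm_le {𝕜 : Type*} [RCLike 𝕜] (n : ℕ) {X Y : 𝕜} {u v : ℝ}
    (hu : 0 ≤ u) (hv : 0 ≤ v) (hX : ‖X‖ ≤ u ^ 2) (hY : ‖Y‖ ≤ v ^ 2) :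
    ‖legendreForm n X Y‖ ≤ ((u + v) ^ 2) ^ n := by
  rw [← pow_mul, mul_comm, pow_mul, (Commute.all u v).add_pow']
  refine le_trans ?_ (Finset.sum_sq_le_sq_sum_of_nonneg fun ij _ => by positivity)
  refine (norm_sum_le _ _).trans (Finset.sum_le_sum fun ij _ => ?_)
  rw [norm_mul, norm_mul, norm_pow, norm_pow, norm_pow, RCLike.norm_natCast, nsmul_eq_mul]
  calc (n.choose ij.1 : ℝ) ^ 2 * (‖X‖ ^ ij.1 * ‖Y‖ ^ ij.2)
      ≤ (n.choose ij.1 : ℝ) ^ 2 * ((u ^ 2) ^ ij.1 * (v ^ 2) ^ ij.2) := by gcongr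
    _ = _ := by ring

theorem sum_antidiagonal_sq_choose_lower (n : ℕ) (X Y p q : ℂ) :
    ∑ ij ∈ antidiagonal (n + 1), ((n + 1).choose ij.1 : ℂ) ^ 2 *
      ((ij.1 : ℂ) ^ 2 * p * X ^ (ij.1 - 1) * Y ^ ij.2 +
        (ij.2 : ℂ) ^ 2 * q * X ^ ij.1 * Y ^ (ij.2 - 1)) =
      ((n : ℂ) + 1) ^ 2 * (p + q) * legendreForm n X Y := by
  simp_rw [mul_add, Finset.sum_add_distrib]
  rw [Finset.Nat.sum_antidiagonal_succ, Finset.Nat.sum_antidiagonal_succ']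
  have e1 : ∀ ij ∈ antidiagonal n,
      ((n + 1).choose (ij.1 + 1) : ℂ) ^ 2 *
        (((ij.1 + 1 : ℕ) : ℂ) ^ 2 * p * X ^ (ij.1 + 1 - 1) * Y ^ ij.2) =
      ((n : ℂ) + 1) ^ 2 * p * ((n.choose ij.1 : ℂ) ^ 2 * (X ^ ij.1 * Y ^ ij.2)) := by
    intro ij _
    have h : ((n : ℂ) + 1) * n.choose ij.1 = (n + 1).choose (ij.1 + 1) * ((ij.1 + 1 : ℕ) : ℂ) := by
      exact_mod_cast Nat.add_one_mul_choose_eq n ij.1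
    rw [Nat.add_sub_cancel]
    calc _ = (((n + 1).choose (ij.1 + 1) : ℂ) * ((ij.1 + 1 : ℕ) : ℂ)) ^ 2 * p *
          (X ^ ij.1 * Y ^ ij.2) := by ring
      _ = _ := by rw [← h]; ring
  have e2 : ∀ ij ∈ antidiagonal n,
      ((n + 1).choose ij.1 : ℂ) ^ 2 *
        (((ij.2 + 1 : ℕ) : ℂ) ^ 2 * q * X ^ ij.1 * Y ^ (ij.2 + 1 - 1)) =
      ((n : ℂ) + 1) ^ 2 * q * ((n.choose ij.1 : ℂ) ^ 2 * (X ^ ij.1 * Y ^ ij.2)) := by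
    intro ij hij
    have hn := mem_antidiagonal.1 hij
    have h : ((n : ℂ) + 1) * n.choose ij.1 = (n + 1).choose ij.1 * ((ij.2 + 1 : ℕ) : ℂ) := by
      have := Nat.choose_mul_succ_eq n ij.1
      rw [show n + 1 - ij.1 = ij.2 + 1 by omega] at this
      rw [mul_comm]
      exact_mod_cast this
    rw [Nat.add_sub_cancel]
    calc _ = (((n + 1).choose ij.1 : ℂ) * ((ij.2 + 1 : ℕ) : ℂ)) ^ 2 * q *
          (X ^ ij.1 * Y ^ ij.2) := by ring
      _ = _ := by rw [← h]; ring
  rw [Finset.sum_congr rfl e1, Finset.sum_congr rfl e2, ← Finset.mul_sum, ← Finset.mul_sum]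
  simp only [legendreForm, Nat.cast_zero]
  ring

theorem hasDerivAt_monomial (p q a : ℂ) (i j : ℕ) :
    HasDerivAt (fun y => (p * y) ^ i * (q * (1 - y)) ^ j)
      ((i : ℂ) * p * (p * a) ^ (i - 1) * (q * (1 - a)) ^ j -
        j * q * (p * a) ^ i * (q * (1 - a)) ^ (j - 1)) a := by
  have d1 : HasDerivAt (fun y : ℂ => p * y) p a := by simpa using (hasDerivAt_id a).const_mul p
  have d2 : HasDerivAt (fun y : ℂ => q * (1 - y)) (-q) a := by
    simpa using ((hasDerivAt_id a).const_sub 1).const_mul q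
  refine ((d1.pow i).mul (d2.pow j)).congr_deriv ?_
  simp only [Pi.pow_apply]
  ring

theorem natCast_mul_pow_pred (x : ℂ) (i : ℕ) : (i : ℂ) * (x * x ^ (i - 1)) = i * x ^ i := by
  cases i with
  | zero => simp
  | succ i => rw [Nat.add_sub_cancel, pow_succ']

theorem hasDerivAt_theta_monomial (p q : ℂ) (a : ℂ) (i j : ℕ) :
    HasDerivAt (fun y => (i * (1 - y) - j * y) * ((p * y) ^ i * (q * (1 - y)) ^ j))
      ((i : ℂ) ^ 2 * p * (p * a) ^ (i - 1) * (q * (1 - a)) ^ j +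
        (j : ℂ) ^ 2 * q * (p * a) ^ i * (q * (1 - a)) ^ (j - 1) -
        ((i : ℂ) + j) * (i + j + 1) * ((p * a) ^ i * (q * (1 - a)) ^ j)) a := by
  have d : HasDerivAt (fun y : ℂ => i * (1 - y) - j * y) (-(i + j)) a := by
    refine ((((hasDerivAt_id a).const_sub 1).const_mul (i : ℂ)).sub
      ((hasDerivAt_id a).const_mul (j : ℂ))).congr_deriv (by ring)
  refine (d.mul (hasDerivAt_monomial p q a i j)).congr_deriv ?_
  have h1 := natCast_mul_pow_pred (p * a) i
  have h2 := natCast_mul_pow_pred (q * (1 - a)) j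
  linear_combination (-(i + j : ℂ) * (q * (1 - a)) ^ j) * h1 -
    ((i + j : ℂ) * (p * a) ^ i) * h2

/-- Partial sums of Brafman's generating function, in the variable `a`. -/
noncomputable def brafmanPartial (p q : ℂ) (N : ℕ) (a : ℂ) : ℂ :=
  ∑ n ∈ Finset.range N, ellCoeff ℂ n * legendreForm n (p * a) (q * (1 - a))

theorem differentiable_brafmanPartial (p q : ℂ) (N : ℕ) :
    Differentiable ℂ (brafmanPartial p q N) := by
  unfold brafmanPartial legendreForm
  fun_prop

theorem mul_deriv_brafmanPartial (p q a : ℂ) (N : ℕ) :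
    a * (1 - a) * deriv (brafmanPartial p q N) a =
      ∑ n ∈ Finset.range N, ellCoeff ℂ n * ∑ ij ∈ antidiagonal n,
        (n.choose ij.1 : ℂ) ^ 2 * ((ij.1 * (1 - a) - ij.2 * a) *
          ((p * a) ^ ij.1 * (q * (1 - a)) ^ ij.2)) := by
  have h : HasDerivAt (brafmanPartial p q N) (∑ n ∈ Finset.range N, ellCoeff ℂ n *
      ∑ ij ∈ antidiagonal n, (n.choose ij.1 : ℂ) ^ 2 *
        ((ij.1 : ℂ) * p * (p * a) ^ (ij.1 - 1) * (q * (1 - a)) ^ ij.2 -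
        ij.2 * q * (p * a) ^ ij.1 * (q * (1 - a)) ^ (ij.2 - 1))) a :=
    HasDerivAt.fun_sum fun n _ => (HasDerivAt.fun_sum fun ij _ =>
      (hasDerivAt_monomial p q a ij.1 ij.2).const_mul _).const_mul _
  rw [h.deriv, Finset.mul_sum]
  refine Finset.sum_congr rfl fun n _ => ?_
  rw [mul_left_comm, Finset.mul_sum]
  congr 1
  refine Finset.sum_congr rfl fun ij _ => ?_
  have h1 := natCast_mul_pow_pred (p * a) ij.1
  have h2 := natCast_mul_pow_pred (q * (1 - a)) ij.2
  linear_combination (n.choose ij.1 : ℂ) ^ 2 * ((1 - a) * (q * (1 - a)) ^ ij.2 * h1 -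
    a * (p * a) ^ ij.1 * h2)

theorem hasDerivAt_theta_brafmanPartial {p q : ℂ} (hpq : p + q = 1) (a : ℂ) (N : ℕ) :
    HasDerivAt (fun y => y * (1 - y) * deriv (brafmanPartial p q (N + 1)) y)
      (brafmanPartial p q (N + 1) a / 4 -
        ((N : ℂ) + 1 / 2) ^ 2 * (ellCoeff ℂ N * legendreForm N (p * a) (q * (1 - a)))) a := by
  simp_rw [mul_deriv_brafmanPartial]
  have h := HasDerivAt.fun_sum (u := Finset.range (N + 1)) fun n _ =>
    (HasDerivAt.fun_sum (u := antidiagonal n) fun ij _ =>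
      (hasDerivAt_theta_monomial p q a ij.1 ij.2).const_mul
        ((n.choose ij.1 : ℂ) ^ 2)).const_mul (ellCoeff ℂ n)
  refine h.congr_deriv ?_
  have e : ∀ n : ℕ, ∑ ij ∈ antidiagonal n, (n.choose ij.1 : ℂ) ^ 2 *
      ((ij.1 : ℂ) ^ 2 * p * (p * a) ^ (ij.1 - 1) * (q * (1 - a)) ^ ij.2 +
        (ij.2 : ℂ) ^ 2 * q * (p * a) ^ ij.1 * (q * (1 - a)) ^ (ij.2 - 1) -
        ((ij.1 : ℂ) + ij.2) * (ij.1 + ij.2 + 1) * ((p * a) ^ ij.1 * (q * (1 - a)) ^ ij.2)) =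
      ∑ ij ∈ antidiagonal n, (n.choose ij.1 : ℂ) ^ 2 *
      ((ij.1 : ℂ) ^ 2 * p * (p * a) ^ (ij.1 - 1) * (q * (1 - a)) ^ ij.2 +
        (ij.2 : ℂ) ^ 2 * q * (p * a) ^ ij.1 * (q * (1 - a)) ^ (ij.2 - 1)) -
      (n : ℂ) * (n + 1) * legendreForm n (p * a) (q * (1 - a)) := by
    intro n
    rw [legendreForm, Finset.mul_sum, ← Finset.sum_sub_distrib]
    refine Finset.sum_congr rfl fun ij hij => ?_
    have : (n : ℂ) = ij.1 + ij.2 := by exact_mod_cast (mem_antidiagonal.1 hij).symm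
    rw [this]
    ring
  simp_rw [e]
  induction N with
  | zero => simp [brafmanPartial, legendreForm]; ring
  | succ N ih =>
    have ih := ih (HasDerivAt.fun_sum (u := Finset.range (N + 1)) fun n _ =>
      (HasDerivAt.fun_sum (u := antidiagonal n) fun ij _ =>
      (hasDerivAt_theta_monomial p q a ij.1 ij.2).const_mul
        ((n.choose ij.1 : ℂ) ^ 2)).const_mul (ellCoeff ℂ n))
    rw [Finset.sum_range_succ, ih, sum_antidiagonal_sq_choose_lower, hpq,
      brafmanPartial, brafmanPartial, Finset.sum_range_succ _ (N + 1)]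
    have hc := ellCoeff_succ (𝕜 := ℂ) N
    push_cast
    linear_combination legendreForm N (p * a) (q * (1 - a)) * hc

theorem ellF_ne_zero {𝕜 : Type*} [RCLike 𝕜] {x : 𝕜} (hx : ‖x‖ < 1 / 2) : ellF x ≠ 0 := by
  have hx1 : ‖x‖ < 1 := by linarith
  have h := (hasRadius_ellCoeff (𝕜 := 𝕜)).tsum_mul_self hx1
  rw [ellCoeff_zero] at h
  have hb : ‖∑' n, ellCoeff 𝕜 (n + 1) * x ^ n‖ ≤ (1 - ‖x‖)⁻¹ := by
    refine tsum_of_norm_bounded (hasSum_geometric_of_lt_one (norm_nonneg x) hx1) fun n => ?_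
    rw [norm_mul, norm_pow, norm_ellCoeff]
    exact mul_le_of_le_one_left (by positivity) (ellCoeff_le_one _)
  intro h0
  have h0' : ∑' n, ellCoeff 𝕜 n * x ^ n = 0 := h0
  rw [h0'] at h
  have h1 : ‖x * ∑' n, ellCoeff 𝕜 (n + 1) * x ^ n‖ = 1 := by rw [h]; simp
  rw [norm_mul] at h1
  have h2 : ‖x‖ * (1 - ‖x‖)⁻¹ < 1 := by
    rw [← div_eq_mul_inv, div_lt_one (by linarith)]
    linarith
  nlinarith [mul_le_mul_of_nonneg_left hb (norm_nonneg x)]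

/-- A solution of the hypergeometric equation that is regular at the origin is a multiple of
`ellF`. -/
theorem eq_mul_ellF_of_hasDerivAt {h : ℂ → ℂ} {r : ℝ} (hr : r ≤ 1 / 2)
    (hh : DifferentiableOn ℂ h (Metric.ball 0 r))
    (hode : ∀ y ∈ Metric.ball (0 : ℂ) r,
      HasDerivAt (fun y => y * (1 - y) * deriv h y) (h y / 4) y)
    {a : ℂ} (ha : ‖a‖ < r) : h a = h 0 * ellF a := by
  have hr0 : 0 < r := (norm_nonneg a).trans_lt ha
  have hB := Metric.isOpen_ball (x := (0 : ℂ)) (ε := r)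
  have hpre := (convex_ball (0 : ℂ) r).isPreconnected
  have hn : ∀ y ∈ Metric.ball (0 : ℂ) r, ‖y‖ < 1 / 2 := fun y hy =>
    (mem_ball_zero_iff.1 hy).trans_le hr
  have hd : ∀ y ∈ Metric.ball (0 : ℂ) r, HasDerivAt h (deriv h y) y := fun y hy =>
    (hh.differentiableAt (hB.mem_nhds hy)).hasDerivAt
  have hF : ∀ y ∈ Metric.ball (0 : ℂ) r, HasDerivAt ellF (ellF' y) y := fun y hy =>
    hasDerivAt_ellF ((hn y hy).trans (by norm_num))
  set W : ℂ → ℂ := fun y => h y * (y * (1 - y) * ellF' y) - y * (1 - y) * deriv h y * ellF y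
    with hW
  have dW : ∀ y ∈ Metric.ball (0 : ℂ) r, HasDerivAt W 0 y := fun y hy => by
    refine (((hd y hy).mul (hasDerivAt_ellTheta ((hn y hy).trans (by norm_num)))).sub
      ((hode y hy).mul (hF y hy))).congr_deriv ?_
    ring
  have h0 : (0 : ℂ) ∈ Metric.ball (0 : ℂ) r := Metric.mem_ball_self hr0
  have W0 : ∀ y ∈ Metric.ball (0 : ℂ) r, W y = 0 := fun y hy => by
    have := hB.is_const_of_deriv_eq_zero hpre
      (fun y hy => (dW y hy).differentiableAt.differentiableWithinAt)
      (fun y hy => (dW y hy).deriv) hy h0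
    rw [this]
    simp [hW]
  set K : ℂ → ℂ := fun y => deriv h y * ellF y - h y * ellF' y with hK
  have K0 : ∀ y ∈ Metric.ball (0 : ℂ) r, K y = 0 := fun y hy => by
    by_cases hy0 : y = 0
    · subst hy0
      have dK : DifferentiableAt ℂ K 0 :=
        (((hh.deriv hB).differentiableAt (hB.mem_nhds hy)).mul (hF 0 hy).differentiableAt).sub
          ((hd 0 hy).differentiableAt.mul
            (hasRadius_ellCoeff.derivCoeff.hasDerivAt (by simp)).differentiableAt)
      have d1 : HasDerivAt (fun y => y * (1 - y) * K y) (K 0) 0 := by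
        refine (((hasDerivAt_id (0 : ℂ)).mul ((hasDerivAt_id (0 : ℂ)).const_sub 1)).mul
          dK.hasDerivAt).congr_deriv ?_
        simp
      have d2 : HasDerivAt (fun y => y * (1 - y) * K y) 0 0 := by
        refine (hasDerivAt_const (0 : ℂ) (0 : ℂ)).congr_of_eventuallyEq ?_
        filter_upwards [hB.mem_nhds hy] with z hz
        have := W0 z hz
        simp only [hW] at this
        simp only [hK]
        linear_combination -this
      exact d1.unique d2
    · have hy1 : 1 - y ≠ 0 := by
        intro h1
        have h2 := hn y hy
        rw [show y = 1 by linear_combination -h1, norm_one] at h2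
        norm_num at h2
      have := W0 y hy
      simp only [hW] at this
      have h3 : y * (1 - y) * K y = 0 := by simp only [hK]; linear_combination -this
      simpa [hy0, hy1] using h3
  have dq : ∀ y ∈ Metric.ball (0 : ℂ) r, HasDerivAt (fun y => h y / ellF y) 0 y := fun y hy => by
    refine ((hd y hy).div (hF y hy) (ellF_ne_zero (hn y hy))).congr_deriv ?_
    have : deriv h y * ellF y - h y * ellF' y = 0 := K0 y hy
    rw [this, zero_div]
  have ha' : a ∈ Metric.ball (0 : ℂ) r := mem_ball_zero_iff.2 ha
  have := hB.is_const_of_deriv_eq_zero hpre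
      (fun y hy => (dq y hy).differentiableAt.differentiableWithinAt)
      (fun y hy => (dq y hy).deriv) ha' h0
  simp only [ellF_zero, div_one] at this
  rwa [div_eq_iff (ellF_ne_zero (hn a ha'))] at this

/-- Brafman's generating function for `C(2n,n)² P_n`. -/
theorem tsum_ellCoeff_mul_legendreForm {p q : ℂ} (hpq : p + q = 1) {r u v : ℝ} (hr : r ≤ 1 / 2)
    (hu : 0 ≤ u) (hv : 0 ≤ v) (huv : u + v < 1) (hpu : ‖p‖ * r ≤ u ^ 2)
    (hqv : ‖q‖ * (1 + r) ≤ v ^ 2) {a : ℂ} (ha : ‖a‖ < r) :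
    ∑' n, ellCoeff ℂ n * legendreForm n (p * a) (q * (1 - a)) = ellF q * ellF a := by
  have hr0 : 0 < r := (norm_nonneg a).trans_lt ha
  have hB := Metric.isOpen_ball (x := (0 : ℂ)) (ε := r)
  have hw0 : 0 ≤ (u + v) ^ 2 := by positivity
  have hw1 : (u + v) ^ 2 < 1 := by nlinarith
  have hbound : ∀ n, ∀ y ∈ Metric.ball (0 : ℂ) r,
      ‖ellCoeff ℂ n * legendreForm n (p * y) (q * (1 - y))‖ ≤ ((u + v) ^ 2) ^ n := by
    intro n y hy
    have hy' : ‖y‖ ≤ r := (mem_ball_zero_iff.1 hy).le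
    rw [norm_mul, norm_ellCoeff]
    refine (mul_le_of_le_one_left (norm_nonneg _) (ellCoeff_le_one n)).trans
      (norm_legendreForm_le n hu hv ?_ ?_)
    · rw [norm_mul]
      exact (mul_le_mul_of_nonneg_left hy' (norm_nonneg p)).trans hpu
    · rw [norm_mul]
      refine (mul_le_mul_of_nonneg_left ?_ (norm_nonneg q)).trans hqv
      exact (norm_sub_le _ _).trans (by simpa using hy')
  set h : ℂ → ℂ := fun y => ∑' n, ellCoeff ℂ n * legendreForm n (p * y) (q * (1 - y)) with hh
  have hlim : TendstoLocallyUniformlyOn (brafmanPartial p q) h atTop (Metric.ball 0 r) :=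
    (tendstoUniformlyOn_tsum_nat (summable_geometric_of_lt_one hw0 hw1)
      hbound).tendstoLocallyUniformlyOn
  have hdiff : ∀ N, DifferentiableOn ℂ (brafmanPartial p q N) (Metric.ball 0 r) := fun N =>
    (differentiable_brafmanPartial p q N).differentiableOn
  have hlim1 := hlim.deriv (Eventually.of_forall hdiff) hB
  have hlim2 := hlim1.deriv (Eventually.of_forall fun N => (hdiff N).deriv hB) hB
  have hd0 := hlim.differentiableOn (Eventually.of_forall hdiff) hB
  have hode : ∀ y ∈ Metric.ball (0 : ℂ) r,
      HasDerivAt (fun y => y * (1 - y) * deriv h y) (h y / 4) y := by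
    intro y hy
    have dpoly : HasDerivAt (fun y : ℂ => y * (1 - y)) (1 - 2 * y) y := by
      refine ((hasDerivAt_id y).mul ((hasDerivAt_id y).const_sub 1)).congr_deriv ?_
      simp only [id_eq]
      ring
    have d := dpoly.mul ((hd0.deriv hB).differentiableAt (hB.mem_nhds hy)).hasDerivAt
    refine d.congr_deriv ?_
    have t1 := (((hlim1.tendsto_at hy).const_mul (1 - 2 * y)).add
      ((hlim2.tendsto_at hy).const_mul (y * (1 - y)))).comp (tendsto_add_atTop_nat 1)
    have hT : Tendsto (fun N : ℕ => ((N : ℂ) + 1 / 2) ^ 2 *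
        (ellCoeff ℂ N * legendreForm N (p * y) (q * (1 - y)))) atTop (nhds 0) := by
      have hs : Summable fun N : ℕ => ((N : ℝ) ^ 2 + N + 1 / 4) * ((u + v) ^ 2) ^ N := by
        have hnorm : ‖(u + v) ^ 2‖ < 1 := by rwa [Real.norm_of_nonneg hw0]
        have s2 := summable_pow_mul_geometric_of_norm_lt_one 2 hnorm
        have s1 := summable_pow_mul_geometric_of_norm_lt_one 1 hnorm
        have s0 := summable_pow_mul_geometric_of_norm_lt_one 0 hnorm
        refine ((s2.add s1).add (s0.mul_left (1 / 4))).congr fun N => by ring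
      refine squeeze_zero_norm (fun N => ?_) hs.tendsto_atTop_zero
      rw [norm_mul]
      have e : ‖((N : ℂ) + 1 / 2) ^ 2‖ = (N : ℝ) ^ 2 + N + 1 / 4 := by
        rw [norm_pow, show (N : ℂ) + 1 / 2 = (((N : ℝ) + 1 / 2 : ℝ) : ℂ) by push_cast; ring,
          Complex.norm_real, Real.norm_of_nonneg (by positivity)]
        ring
      rw [e]
      exact mul_le_mul_of_nonneg_left (hbound N y hy) (by positivity)
    have t2 := (((hlim.tendsto_at hy).div_const 4).comp (tendsto_add_atTop_nat 1)).sub hT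
    rw [sub_zero] at t2
    refine tendsto_nhds_unique t1 (t2.congr fun N => ?_)
    have e1 := hasDerivAt_theta_brafmanPartial hpq y N
    have e2 := dpoly.mul (((hdiff (N + 1)).deriv hB).differentiableAt
      (hB.mem_nhds hy)).hasDerivAt
    exact e1.unique e2
  have key := eq_mul_ellF_of_hasDerivAt hr hd0 hode ha
  have hz : h 0 = ellF q := by
    simp only [hh, ellF]
    refine tsum_congr fun n => ?_
    rw [legendreForm, Finset.sum_eq_single (0, n)]
    · simp
    · rintro ⟨i, j⟩ hij hne
      have hi : i ≠ 0 := by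
        rintro rfl
        have := mem_antidiagonal.1 hij
        simp_all
      simp [hi]
    · intro hn
      exact absurd (mem_antidiagonal.2 (zero_add n)) hn
  rw [hz] at key
  exact key

theorem legendreForm_mul {R : Type*} [CommSemiring R] (n : ℕ) (c X Y : R) :
    legendreForm n (c * X) (c * Y) = c ^ n * legendreForm n X Y := by
  unfold legendreForm
  rw [Finset.mul_sum]
  refine Finset.sum_congr rfl fun ij hij => ?_
  rw [← mem_antidiagonal.1 hij, pow_add]
  ring

theorem legendreP_eq_legendreForm (n : ℕ) (x : ℝ) :
    legendreP n x = legendreForm n ((x - 1) / 2) ((x + 1) / 2) := by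
  rw [show (x - 1) / 2 = 2⁻¹ * (x - 1) by ring, show (x + 1) / 2 = 2⁻¹ * (x + 1) by ring,
    legendreForm_mul, legendreP, legendreForm, ← Finset.Nat.sum_antidiagonal_swap,
    Finset.Nat.sum_antidiagonal_eq_sum_range_succ_mk]
  congr 1
  refine Finset.sum_congr rfl fun j hj => ?_
  have hj' : j ≤ n := Nat.lt_succ_iff.1 (Finset.mem_range.1 hj)
  simp only [Prod.swap, Nat.choose_symm hj']
  ring

theorem ofReal_ellF (x : ℝ) : ((ellF x : ℝ) : ℂ) = ellF (x : ℂ) := by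
  simp [ellF, ellCoeff, Complex.ofReal_tsum]

theorem tsum_ellCoeff_mul_legendreForm_real {α β : ℝ} (hα0 : 0 ≤ α) (hα1 : α < 1 / 20)
    (hβ0 : 11 / 25 ≤ β) (hβ1 : β ≤ 9 / 20) :
    ∑' n, ellCoeff ℝ n * legendreForm n ((1 - β) * α) (β * (1 - α)) = ellF α * ellF β := by
  have h := tsum_ellCoeff_mul_legendreForm (p := ((1 - β : ℝ) : ℂ)) (q := (β : ℂ))
    (by push_cast; ring) (r := 1 / 20) (u := 17 / 100) (v := 69 / 100) (by norm_num) (by norm_num)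
    (by norm_num) (by norm_num)
    (by rw [Complex.norm_real, Real.norm_of_nonneg (by linarith)]; linarith)
    (by rw [Complex.norm_real, Real.norm_of_nonneg (by linarith)]; linarith)
    (a := (α : ℂ)) (by rwa [Complex.norm_real, Real.norm_of_nonneg hα0])
  have hc : ∀ n, ((ellCoeff ℝ n * legendreForm n ((1 - β) * α) (β * (1 - α)) : ℝ) : ℂ) =
      ellCoeff ℂ n * legendreForm n (((1 - β : ℝ) : ℂ) * α) (β * (1 - α)) := by
    intro n
    simp [ellCoeff, legendreForm]
  rw [← tsum_congr hc, ← Complex.ofReal_tsum, ← ofReal_ellF, ← ofReal_ellF] at h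
  rw [mul_comm (ellF α)]
  exact_mod_cast h

end Brafman

section Evaluation

/-- The coefficients of the restriction of Brafman's generating function to the ray through
`(1, 96/5)`, weighted by `n ^ k`. -/
noncomputable def rayCoeff (k n : ℕ) : ℝ :=
  (n : ℝ) ^ k * (ellCoeff ℝ n * legendreForm n 1 (96 / 5))

/-- The power series with coefficients `rayCoeff k`. -/
noncomputable def raySum (k : ℕ) (x : ℝ) : ℝ := ∑' n, rayCoeff k n * x ^ n

theorem hasRadius_rayCoeff (k : ℕ) : HasRadius (rayCoeff k) (1 / 30) := by
  induction k with
  | zero =>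
    intro r hr hr1
    refine Summable.of_nonneg_of_le (fun n => by positivity) (fun n => ?_)
      (summable_geometric_of_lt_one (r := 30 * r) (by positivity) (by linarith))
    have h := norm_legendreForm_le (𝕜 := ℝ) n (X := 1) (Y := 96 / 5) (u := 1) (v := 22 / 5)
      (by norm_num) (by norm_num) (by norm_num) (by norm_num)
    rw [rayCoeff, pow_zero, one_mul, norm_mul, norm_ellCoeff, mul_pow]
    gcongr
    calc ellCoeff ℝ n * ‖legendreForm n (1 : ℝ) (96 / 5)‖ ≤ ‖legendreForm n (1 : ℝ) (96 / 5)‖ :=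
          mul_le_of_le_one_left (norm_nonneg _) (ellCoeff_le_one n)
      _ ≤ _ := h
      _ ≤ 30 ^ n := by gcongr; norm_num
  | succ k ih =>
    have e : rayCoeff (k + 1) = fun n : ℕ => (n : ℝ) * rayCoeff k n := by
      funext n
      rw [rayCoeff, rayCoeff]
      ring
    rw [e]
    exact ih.nat_mul

theorem hasDerivAt_raySum (k : ℕ) {x : ℝ} (hx0 : 0 < x) (hx : x < 1 / 30) :
    HasDerivAt (raySum k) (raySum (k + 1) x / x) x := by
  have hx' : ‖x‖ < 1 / 30 := by rwa [Real.norm_of_nonneg hx0.le]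
  refine ((hasRadius_rayCoeff k).hasDerivAt hx').congr_deriv ?_
  have h := (hasRadius_rayCoeff k).nat_mul.tsum_mul_self hx'
  simp only [Nat.cast_zero, zero_mul, sub_zero] at h
  rw [eq_div_iff hx0.ne', mul_comm, h]
  refine tsum_congr fun n => ?_
  rw [rayCoeff, rayCoeff]
  ring

/-- The parameter `c t / (1 + c t)` of the elliptic integrals along the ray. -/
noncomputable def rayMod (c t : ℝ) : ℝ := c * t / (1 + c * t)

theorem hasDerivAt_rayMod {c t : ℝ} (ht : 0 < 1 + c * t) :
    HasDerivAt (rayMod c) (c / (1 + c * t) ^ 2) t := by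
  have d : HasDerivAt (fun y => c * y) c t := by simpa using (hasDerivAt_id t).const_mul c
  refine (d.div (d.const_add 1) ht.ne').congr_deriv ?_
  ring

theorem norm_rayMod_lt {c t : ℝ} (ht : 0 < c * t) : ‖rayMod c t‖ < 1 := by
  rw [rayMod, Real.norm_of_nonneg (by positivity), div_lt_one (by linarith)]
  linarith

/-- `ellF` along the ray. -/
noncomputable def rayF (c t : ℝ) : ℝ := ellF (rayMod c t)

/-- The logarithmic derivative `t d/dt` of `rayF`. -/
noncomputable def rayTheta (c t : ℝ) : ℝ :=
  rayMod c t * (1 - rayMod c t) * ellF' (rayMod c t)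

theorem hasDerivAt_rayF {c t : ℝ} (hc : 0 < c) (ht : 0 < t) :
    HasDerivAt (rayF c) (rayTheta c t / t) t := by
  have hct : 0 < c * t := mul_pos hc ht
  refine (HasDerivAt.comp t (hasDerivAt_ellF (norm_rayMod_lt hct))
    (hasDerivAt_rayMod (by linarith))).congr_deriv ?_
  rw [rayTheta]
  generalize ellF' (rayMod c t) = w
  have : 1 + c * t ≠ 0 := by linarith
  rw [rayMod]
  field_simp
  ring

theorem hasDerivAt_rayTheta {c t : ℝ} (hc : 0 < c) (ht : 0 < t) :
    HasDerivAt (rayTheta c) (c / (4 * (1 + c * t) ^ 2) * rayF c t) t := by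
  have hct : 0 < c * t := mul_pos hc ht
  refine (HasDerivAt.comp t (hasDerivAt_ellTheta (norm_rayMod_lt hct))
    (hasDerivAt_rayMod (by linarith))).congr_deriv ?_
  rw [rayF]
  have : 1 + c * t ≠ 0 := by linarith
  field_simp

/-- The interval of parameters on which the factorisation is differentiated. -/
def rayInterval : Set ℝ := Set.Ioo (411 / 10000) (425 / 10000)

/-- The ray coordinate as a function of the parameter. -/
noncomputable def rayPoint (t : ℝ) : ℝ := t / ((1 + t) * (1 + 96 / 5 * t))

theorem rayPoint_mem {t : ℝ} (ht : t ∈ rayInterval) : 0 < rayPoint t ∧ rayPoint t < 1 / 30 := by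
  obtain ⟨h0, h1⟩ := ht
  have ht0 : 0 < t := by linarith
  refine ⟨by unfold rayPoint; positivity, ?_⟩
  rw [rayPoint, div_lt_iff₀ (by positivity)]
  nlinarith

theorem raySum_zero {t : ℝ} (ht : t ∈ rayInterval) :
    raySum 0 (rayPoint t) = rayF 1 t * rayF (96 / 5) t := by
  obtain ⟨h0, h1⟩ := ht
  have ht0 : 0 < t := by linarith
  have hα : rayMod 1 t < 1 / 20 := by
    rw [rayMod, div_lt_iff₀ (by linarith)]
    linarith
  have hβ0 : 11 / 25 ≤ rayMod (96 / 5) t := by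
    rw [rayMod, le_div_iff₀ (by linarith)]
    linarith
  have hβ1 : rayMod (96 / 5) t ≤ 9 / 20 := by
    rw [rayMod, div_le_iff₀ (by linarith)]
    linarith
  rw [rayF, rayF, ← tsum_ellCoeff_mul_legendreForm_real
    (by unfold rayMod; positivity) hα hβ0 hβ1, raySum]
  refine tsum_congr fun n => ?_
  have e1 : (1 - rayMod (96 / 5) t) * rayMod 1 t = rayPoint t * 1 := by
    unfold rayMod rayPoint
    field_simp
    ring
  have e2 : rayMod (96 / 5) t * (1 - rayMod 1 t) = rayPoint t * (96 / 5) := by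
    unfold rayMod rayPoint
    field_simp
    ring
  rw [e1, e2, legendreForm_mul, rayCoeff]
  ring

/-- The reciprocal of the logarithmic derivative of `rayPoint`. -/
noncomputable def rayScale (t : ℝ) : ℝ := (1 + t) * (1 + 96 / 5 * t) / (1 - 96 / 5 * t ^ 2)

theorem hasDerivAt_rayPoint {t : ℝ} (ht : t ∈ rayInterval) :
    HasDerivAt rayPoint (rayPoint t / (t * rayScale t)) t := by
  obtain ⟨h0, h1⟩ := ht
  have ht0 : 0 < t := by linarith
  have hs : 1 - 96 / 5 * t ^ 2 ≠ 0 := by nlinarith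
  have d : HasDerivAt (fun y : ℝ => (1 + y) * (1 + 96 / 5 * y))
      (1 * (1 + 96 / 5 * t) + (1 + t) * (96 / 5)) t :=
    ((hasDerivAt_id t).const_add 1).mul
      (((hasDerivAt_id t).const_mul (96 / 5)).const_add 1 |>.congr_deriv (by ring))
  refine ((hasDerivAt_id t).div d (by positivity)).congr_deriv ?_
  simp only [rayPoint, rayScale, id_eq]
  field_simp
  ring

theorem raySum_succ {k : ℕ} {A B H : ℝ → ℝ} {A' B' H' t : ℝ} (ht : t ∈ rayInterval)
    (hA : HasDerivAt A A' t) (hB : HasDerivAt B B' t) (hH : HasDerivAt H H' t)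
    (h : ∀ y ∈ rayInterval, raySum k (rayPoint y) = A y * (rayF 1 y * rayF (96 / 5) y) +
      B y * (rayTheta 1 y * rayF (96 / 5) y + rayF 1 y * rayTheta (96 / 5) y) +
      H y * (rayTheta 1 y * rayTheta (96 / 5) y)) :
    raySum (k + 1) (rayPoint t) = rayScale t *
      ((t * A' + B t * (t / (4 * (1 + t) ^ 2) + 96 / 5 * t / (4 * (1 + 96 / 5 * t) ^ 2))) *
        (rayF 1 t * rayF (96 / 5) t) +
      (t * B' + A t) * (rayTheta 1 t * rayF (96 / 5) t + rayF 1 t * rayTheta (96 / 5) t) +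
      (t * H' + 2 * B t) * (rayTheta 1 t * rayTheta (96 / 5) t) +
      H t * (t / (4 * (1 + t) ^ 2) * (rayF 1 t * rayTheta (96 / 5) t) +
        96 / 5 * t / (4 * (1 + 96 / 5 * t) ^ 2) * (rayTheta 1 t * rayF (96 / 5) t))) := by
  have ht' := ht
  obtain ⟨h0, h1⟩ := ht
  have ht0 : 0 < t := by linarith
  have hs : 0 < 1 - 96 / 5 * t ^ 2 := by nlinarith
  have hsc : 0 < rayScale t := by unfold rayScale; positivity
  obtain ⟨hp0, hp1⟩ := rayPoint_mem ht'
  have df := hasDerivAt_rayF one_pos ht0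
  have dg := hasDerivAt_rayF (c := 96 / 5) (by norm_num) ht0
  have dφ := hasDerivAt_rayTheta one_pos ht0
  have dψ := hasDerivAt_rayTheta (c := 96 / 5) (by norm_num) ht0
  have d1 := HasDerivAt.comp t (hasDerivAt_raySum k hp0 hp1) (hasDerivAt_rayPoint ht')
  have d2 := ((hA.mul (df.mul dg)).add (hB.mul ((dφ.mul dg).add (df.mul dψ)))).add
    (hH.mul (dφ.mul dψ))
  have d3 := d2.congr_of_eventuallyEq (f₁ := raySum k ∘ rayPoint) (by
    filter_upwards [isOpen_Ioo.mem_nhds ht'] with y hy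
    exact h y hy)
  have key := d1.unique d3
  simp only [Pi.mul_apply, Pi.add_apply] at key
  have e : raySum (k + 1) (rayPoint t) = rayScale t * (t *
      (raySum (k + 1) (rayPoint t) / rayPoint t * (rayPoint t / (t * rayScale t)))) := by
    field_simp
  rw [e, key]
  congr 1
  field_simp
  ring

/-- The derivative of `rayScale`. -/
noncomputable def rayScale' (t : ℝ) : ℝ :=
  (101 / 5 + 384 / 5 * t + 9696 / 25 * t ^ 2) / (1 - 96 / 5 * t ^ 2) ^ 2

theorem hasDerivAt_one_sub_mul_sq (t : ℝ) :
    HasDerivAt (fun y : ℝ => 1 - 96 / 5 * y ^ 2) (-(192 / 5 * t)) t :=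
  (((hasDerivAt_pow 2 t).const_mul (96 / 5)).const_sub 1).congr_deriv (by norm_num; ring)

theorem hasDerivAt_rayScale {t : ℝ} (ht : t ∈ rayInterval) :
    HasDerivAt rayScale (rayScale' t) t := by
  obtain ⟨h0, h1⟩ := ht
  have hs : 1 - 96 / 5 * t ^ 2 ≠ 0 := by nlinarith
  have d : HasDerivAt (fun y : ℝ => (1 + y) * (1 + 96 / 5 * y))
      (1 * (1 + 96 / 5 * t) + (1 + t) * (96 / 5)) t :=
    ((hasDerivAt_id t).const_add 1).mul
      (((hasDerivAt_id t).const_mul (96 / 5)).const_add 1 |>.congr_deriv (by ring))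
  refine (d.div (hasDerivAt_one_sub_mul_sq t) hs).congr_deriv ?_
  rw [rayScale']
  ring

theorem raySum_one {t : ℝ} (ht : t ∈ rayInterval) :
    raySum 1 (rayPoint t) = rayScale t *
      (rayTheta 1 t * rayF (96 / 5) t + rayF 1 t * rayTheta (96 / 5) t) := by
  have h := raySum_succ (k := 0) ht (hasDerivAt_const t 1) (hasDerivAt_const t 0)
    (hasDerivAt_const t 0) (fun y hy => by rw [raySum_zero hy]; ring)
  rw [h]
  ring

theorem raySum_two {t : ℝ} (ht : t ∈ rayInterval) :
    raySum 2 (rayPoint t) =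
      rayScale t ^ 2 * (t / (4 * (1 + t) ^ 2) + 96 / 5 * t / (4 * (1 + 96 / 5 * t) ^ 2)) *
        (rayF 1 t * rayF (96 / 5) t) +
      rayScale t * (t * rayScale' t) *
        (rayTheta 1 t * rayF (96 / 5) t + rayF 1 t * rayTheta (96 / 5) t) +
      2 * rayScale t ^ 2 * (rayTheta 1 t * rayTheta (96 / 5) t) := by
  have h := raySum_succ (k := 1) ht (hasDerivAt_const t 0) (hasDerivAt_rayScale ht)
    (hasDerivAt_const t 0) (fun y hy => by rw [raySum_one hy]; ring)
  rw [h]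
  ring

theorem mem_rayInterval : (1 / 24 : ℝ) ∈ rayInterval := by
  constructor <;> norm_num

theorem rayPoint_eq : rayPoint (1 / 24) = 1 / 45 := by
  norm_num [rayPoint]

theorem hasDerivAt_rayScale' : HasDerivAt rayScale' (4927968 / 24389) (1 / 24) := by
  have d : HasDerivAt (fun y : ℝ => 101 / 5 + 384 / 5 * y + 9696 / 25 * y ^ 2)
      (384 / 5 + 9696 / 25 * (2 * (1 / 24))) (1 / 24) :=
    ((((hasDerivAt_id _).const_mul (384 / 5)).const_add (101 / 5)).add
      ((hasDerivAt_pow 2 _).const_mul (9696 / 25))).congr_deriv (by norm_num)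
  refine (d.div ((hasDerivAt_one_sub_mul_sq (1 / 24)).pow 2) (by norm_num)).congr_deriv ?_
  norm_num

theorem hasDerivAt_quarter_mul {c t : ℝ} (ht : 1 + c * t ≠ 0) :
    HasDerivAt (fun y => c * y / (4 * (1 + c * y) ^ 2))
      (c * (1 - c * t) / (4 * (1 + c * t) ^ 3)) t := by
  have d : HasDerivAt (fun y => c * y) c t := by simpa using (hasDerivAt_id t).const_mul c
  refine (d.div (((d.const_add 1).pow 2).const_mul 4)
    (mul_ne_zero four_ne_zero (pow_ne_zero 2 ht))).congr_deriv ?_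
  norm_num
  field_simp
  ring

theorem raySum_combination :
    5537 * raySum 0 (1 / 45) + 11304 * raySum 1 (1 / 45) - 173328 * raySum 2 (1 / 45) +
      53824 * raySum 3 (1 / 45) = 87750 / π := by
  have hm := mem_rayInterval
  have hk := hasDerivAt_rayScale hm
  have ha : HasDerivAt (fun y : ℝ => y / (4 * (1 + y) ^ 2))
      (1 * (1 - 1 / 24) / (4 * (1 + 1 / 24) ^ 3)) (1 / 24) := by
    simpa only [one_mul] using hasDerivAt_quarter_mul (c := 1) (t := 1 / 24) (by norm_num)
  have hb := hasDerivAt_quarter_mul (c := 96 / 5) (t := 1 / 24) (by norm_num)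
  have h0 := raySum_zero hm
  have h1 := raySum_one hm
  have h2 := raySum_two hm
  have h3 := raySum_succ (k := 2) hm ((hk.pow 2).mul (ha.add hb))
    (hk.mul ((hasDerivAt_id _).mul hasDerivAt_rayScale')) ((hk.pow 2).const_mul 2)
    (fun y hy => by
      rw [raySum_two hy]
      simp only [Pi.mul_apply, Pi.add_apply, Pi.pow_apply, id_eq])
  have hL := legendre_relation_landen (k := 1 / 5) (by norm_num) (by norm_num)
  have e0 : rayScale (1 / 24) = 225 / 116 := by norm_num [rayScale]
  have e1 : rayScale' (1 / 24) = 21666 / 841 := by norm_num [rayScale']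
  have m1 : rayMod 1 (1 / 24) = 1 / 25 := by norm_num [rayMod]
  have m2 : rayMod (96 / 5) (1 / 24) = 4 / 9 := by norm_num [rayMod]
  rw [rayPoint_eq] at h0 h1 h2 h3
  simp only [Pi.mul_apply, Pi.add_apply, Pi.pow_apply, id_eq, rayF, rayTheta, m1, m2, e0, e1]
    at h0 h1 h2 h3
  norm_num at h0 h1 h2 h3 hL
  rw [h0, h1, h2, h3, show 87750 / π = 87750 * π⁻¹ from div_eq_mul_inv _ _, ← hL]
  ring

end Evaluation

theorem summand_eq (n : ℕ) :
    ((2 * n).choose n : ℝ) ^ 2 * legendreP n (101 / 91) * (91 / 3600) ^ n *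
        (5537 + 11304 * (n : ℝ) - 173328 * (n : ℝ) ^ 2 + 53824 * (n : ℝ) ^ 3) =
      5537 * (rayCoeff 0 n * (1 / 45) ^ n) + 11304 * (rayCoeff 1 n * (1 / 45) ^ n) -
        173328 * (rayCoeff 2 n * (1 / 45) ^ n) + 53824 * (rayCoeff 3 n * (1 / 45) ^ n) := by
  have h1 : legendreP n (101 / 91) = (5 / 91) ^ n * legendreForm n 1 (96 / 5) := by
    rw [legendreP_eq_legendreForm, ← legendreForm_mul]
    norm_num
  have h2 : ((2 * n).choose n : ℝ) ^ 2 = ellCoeff ℝ n * 16 ^ n := by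
    rw [ellCoeff, Nat.centralBinom_eq_two_mul_choose, div_mul_cancel₀ _ (by positivity)]
  have h3 : (16 : ℝ) ^ n * (5 / 91) ^ n * (91 / 3600) ^ n = (1 / 45) ^ n := by
    rw [← mul_pow, ← mul_pow]
    norm_num
  rw [h1, h2, ← h3]
  simp only [rayCoeff]
  ring

theorem stmt2 :
    Tendsto (fun N => ∑ n ∈ Finset.range N,
      ((2 * n).choose n : ℝ) ^ 2 * legendreP n (101 / 91) * (91 / 3600) ^ n *
        (5537 + 11304 * (n : ℝ) - 173328 * (n : ℝ) ^ 2 + 53824 * (n : ℝ) ^ 3))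
      atTop (nhds (87750 / π)) := by
  have hs : ∀ k, HasSum (fun n => rayCoeff k n * (1 / 45) ^ n) (raySum k (1 / 45)) := fun k =>
    ((hasRadius_rayCoeff k).summable (by rw [Real.norm_of_nonneg] <;> norm_num)).hasSum
  rw [← raySum_combination]
  simp_rw [summand_eq]
  exact (((((hs 0).mul_left 5537).add ((hs 1).mul_left 11304)).sub
    ((hs 2).mul_left 173328)).add ((hs 3).mul_left 53824)).tendsto_sum_nat
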